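/- Let (X, μ) be a probability space and f ∈ L¹(μ) a real-valued function that is not a.e. equal to a constant. Then there exists d > 0 such that for every ergodic measure-preserving transformation T : X → X, for almost every x ∈ X one has A_{N+1} f(x) > d/N + A_N f(x) for infinitely many N, and A_{N+1} f(x) < −d/N + A_N f(x) for infinitely many N. -/

import Mathlib

open MeasureTheory Filter

/-- Birkhoff (ergodic) average `A_N f(x) = (1/N) ∑_{n=1}^N f(Tⁿ x)`. -/
noncomputable def birkhoffAvg {X : Type*} (T : X → X) (f : X → ℝ) (N : ℕ) (x : X) : ℝ :=
  (N : ℝ)⁻¹ * ∑ n ∈ Finset.Icc 1 N, f (T^[n] x)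

/-- The running maximum `max_{0 ≤ k ≤ n} ∑_{i < k} g (Tⁱ x)` of the Birkhoff sums, defined
through its cocycle recursion. -/
noncomputable def birkhoffMax {X : Type*} (T : X → X) (g : X → ℝ) : ℕ → X → ℝ
  | 0, _ => 0
  | n + 1, x => max 0 (g x + birkhoffMax T g n (T x))

lemma birkhoffMax_nonneg {X : Type*} (T : X → X) (g : X → ℝ) (n : ℕ) (x : X) :
    0 ≤ birkhoffMax T g n x := by
  cases n
  · exact le_rfl
  · exact le_max_left _ _

lemma birkhoffMax_monotone {X : Type*} (T : X → X) (g : X → ℝ) (x : X) :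
    Monotone fun n => birkhoffMax T g n x := by
  refine monotone_nat_of_le_succ fun n => ?_
  induction n generalizing x with
  | zero => exact birkhoffMax_nonneg T g 1 x
  | succ n ih => exact max_le_max_left 0 (add_le_add_right (ih (T x)) _)

lemma birkhoffSum_le_birkhoffMax {X : Type*} (T : X → X) (g : X → ℝ) (n : ℕ) (x : X) :
    birkhoffSum T g n x ≤ birkhoffMax T g n x := by
  induction n generalizing x with
  | zero => exact le_rfl
  | succ n ih =>
    rw [birkhoffSum_succ']
    exact (add_le_add_right (ih (T x)) _).trans (le_max_right _ _)

lemma measurable_birkhoffMax {X : Type*} [MeasurableSpace X] {T : X → X} {g : X → ℝ}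
    (hT : Measurable T) (hg : Measurable g) (n : ℕ) : Measurable (birkhoffMax T g n) := by
  induction n with
  | zero => exact measurable_const
  | succ n ih => exact measurable_const.max (hg.add (ih.comp hT))

lemma integrable_birkhoffMax {X : Type*} [MeasurableSpace X] {μ : Measure X} {T : X → X}
    {g : X → ℝ} (hT : MeasurePreserving T μ μ) (hg : Integrable g μ) (n : ℕ) :
    Integrable (birkhoffMax T g n) μ := by
  induction n with
  | zero => exact integrable_zero _ _ _
  | succ n ih =>
    exact (integrable_zero _ _ _).sup (hg.add (hT.integrable_comp_of_integrable ih))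

lemma bddAbove_birkhoffMax_apply_iff {X : Type*} (T : X → X) (g : X → ℝ) (x : X) :
    BddAbove (Set.range fun n => birkhoffMax T g n (T x)) ↔
      BddAbove (Set.range fun n => birkhoffMax T g n x) := by
  constructor
  · rintro ⟨C, hC⟩
    refine ⟨max 0 (g x + C), ?_⟩
    rintro _ ⟨n, rfl⟩
    refine (birkhoffMax_monotone T g x n.le_succ).trans ?_
    exact max_le_max_left 0 (add_le_add_right (hC ⟨n, rfl⟩) _)
  · rintro ⟨C, hC⟩
    refine ⟨C - g x, ?_⟩
    rintro _ ⟨n, rfl⟩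
    have h₁ : birkhoffMax T g (n + 1) x ≤ C := hC ⟨n + 1, rfl⟩
    have h₂ : g x + birkhoffMax T g n (T x) ≤ birkhoffMax T g (n + 1) x := le_max_right _ _
    show birkhoffMax T g n (T x) ≤ C - g x
    linarith

lemma birkhoffMax_succ_sub {X : Type*} (T : X → X) (g : X → ℝ) (n : ℕ) (x : X) :
    birkhoffMax T g (n + 1) x - birkhoffMax T g n (T x) =
      max (-birkhoffMax T g n (T x)) (g x) := by
  simp [birkhoffMax, ← max_sub_sub_right]

/-- If the running maxima of the Birkhoff sums of `g` diverge almost everywhere, then `g` has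
nonnegative integral. -/
lemma integral_nonneg_of_ae_not_bddAbove_birkhoffMax {X : Type*} [MeasurableSpace X]
    {μ : Measure X} {T : X → X} {g : X → ℝ} (hT : MeasurePreserving T μ μ)
    (hg : Integrable g μ)
    (h : ∀ᵐ x ∂μ, ¬ BddAbove (Set.range fun n => birkhoffMax T g n x)) :
    0 ≤ ∫ x, g x ∂μ := by
  have hM := integrable_birkhoffMax hT hg
  have hMT n : Integrable (fun x => birkhoffMax T g n (T x)) μ :=
    hT.integrable_comp_of_integrable (hM n)
  have hlim : Tendsto
      (fun n => ∫ x, (birkhoffMax T g (n + 1) x - birkhoffMax T g n (T x)) ∂μ) atTop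
      (nhds (∫ x, g x ∂μ)) := by
    refine tendsto_integral_of_dominated_convergence (fun x => |g x|)
      (fun n => ((hM (n + 1)).sub (hMT n)).aestronglyMeasurable) hg.abs (fun n => ?_) ?_
    · refine Eventually.of_forall fun x => ?_
      have h0 := birkhoffMax_nonneg T g n (T x)
      rw [birkhoffMax_succ_sub, Real.norm_eq_abs, abs_le]
      exact ⟨(neg_abs_le _).trans (le_max_right _ _),
        max_le (by linarith [abs_nonneg (g x)]) (le_abs_self _)⟩
    · filter_upwards [h] with x hx
      rw [← bddAbove_birkhoffMax_apply_iff] at hx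
      have hx' := tendsto_atTop_atTop_of_monotone' (birkhoffMax_monotone T g (T x)) hx
      refine tendsto_const_nhds.congr' ?_
      filter_upwards [hx'.eventually_ge_atTop (-g x)] with n hn
      rw [birkhoffMax_succ_sub, max_eq_right (by linarith)]
  refine ge_of_tendsto' hlim fun n => ?_
  have hcomp : ∫ x, birkhoffMax T g n (T x) ∂μ = ∫ x, birkhoffMax T g n x ∂μ := by
    have := integral_map (f := birkhoffMax T g n) hT.aemeasurable
      (hT.map_eq.symm ▸ (hM n).aestronglyMeasurable)
    rw [← this, hT.map_eq]
  rw [integral_sub (hM _) (hMT _), hcomp, sub_nonneg]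
  exact integral_mono (hM _) (hM _) fun x => birkhoffMax_monotone T g x n.le_succ

/-- For an ergodic map, the Birkhoff sums of a function with negative integral are almost
everywhere bounded above. -/
lemma ae_bddAbove_birkhoffSum {X : Type*} [MeasurableSpace X] {μ : Measure X} {T : X → X}
    {g : X → ℝ} (hT : Ergodic T μ) (hg : Integrable g μ) (hneg : ∫ x, g x ∂μ < 0) :
    ∀ᵐ x ∂μ, BddAbove (Set.range fun n => birkhoffSum T g n x) := by
  obtain ⟨g', hg'm, hgg'⟩ := hg.1
  have hg' : Integrable g' μ := hg.congr hgg'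
  have hbdd : ∀ᵐ x ∂μ, BddAbove (Set.range fun n => birkhoffMax T g' n x) := by
    refine (hT.toPreErgodic.ae_mem_or_ae_notMem
      (s := {x | BddAbove (Set.range fun n => birkhoffMax T g' n x)})
      (measurableSet_bddAbove_range
        (measurable_birkhoffMax hT.measurable hg'm.measurable))
      (Set.ext fun x => bddAbove_birkhoffMax_apply_iff T g' x)).resolve_right fun h => ?_
    have := integral_nonneg_of_ae_not_bddAbove_birkhoffMax hT.toMeasurePreserving hg' h
    rw [integral_congr_ae hgg'] at hneg
    exact hneg.not_ge this
  filter_upwards [hbdd, ae_all_iff.2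
    (hT.quasiMeasurePreserving.birkhoffSum_ae_eq_of_ae_eq hgg')] with x ⟨C, hC⟩ hx
  refine ⟨C, ?_⟩
  rintro _ ⟨n, rfl⟩
  exact ((hx n).trans_le (birkhoffSum_le_birkhoffMax T g' n x)).trans (hC ⟨n, rfl⟩)

/-- For an ergodic map, almost every orbit visits a set of positive measure infinitely often. -/
lemma Ergodic.ae_frequently_iterate_mem {X : Type*} [MeasurableSpace X] {μ : Measure X}
    [IsFiniteMeasure μ] {T : X → X} {s : Set X} (hT : Ergodic T μ) (hs : NullMeasurableSet s μ)
    (h0 : μ s ≠ 0) : ∀ᵐ x ∂μ, ∃ᶠ n in atTop, T^[n] x ∈ s := by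
  have hU : NullMeasurableSet (⋃ n, T^[n] ⁻¹' s) μ :=
    .iUnion fun n => hs.preimage (hT.quasiMeasurePreserving.iterate n)
  have hsub : T ⁻¹' (⋃ n, T^[n] ⁻¹' s) ⊆ ⋃ n, T^[n] ⁻¹' s := by
    intro x hx
    simp only [Set.mem_preimage, Set.mem_iUnion] at hx ⊢
    obtain ⟨n, hn⟩ := hx
    exact ⟨n + 1, hn⟩
  have huniv : (⋃ n, T^[n] ⁻¹' s) =ᵐ[μ] Set.univ := by
    refine (hT.ae_empty_or_univ_of_preimage_ae_le hU
      (LE.le.eventuallyLE hsub)).resolve_left fun h => h0 ?_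
    exact measure_mono_null (Set.subset_iUnion (fun n => T^[n] ⁻¹' s) 0) (ae_eq_empty.1 h)
  filter_upwards [eventuallyEq_univ.1 huniv,
    hT.toMeasurePreserving.conservative.ae_forall_image_mem_imp_frequently_image_mem hs]
    with x hx hx'
  obtain ⟨k, hk⟩ := Set.mem_iUnion.1 hx
  exact hx' k hk

lemma birkhoffAvg_eq_birkhoffSum {X : Type*} (T : X → X) (f : X → ℝ) (N : ℕ) (x : X) :
    birkhoffAvg T f N x = (N : ℝ)⁻¹ * birkhoffSum T f N (T x) := by
  rw [birkhoffAvg, birkhoffSum, Finset.range_eq_Ico, ← Finset.Ico_add_one_right_eq_Icc,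
    Finset.sum_Ico_eq_sum_range, Finset.sum_Ico_eq_sum_range]
  simp [add_comm 1]

/-- The increments of the ergodic averages of `f` exceed `d / N` infinitely often as soon as `f`
exceeds its mean by more than `d` on a set of positive measure. -/
lemma ae_frequently_birkhoffAvg_succ_gt {X : Type*} [MeasurableSpace X] {μ : Measure X}
    [IsProbabilityMeasure μ] {T : X → X} {f : X → ℝ} (hT : Ergodic T μ) (hf : Integrable f μ)
    {a d : ℝ} (had : ∫ x, f x ∂μ + d < a) (ha : μ {x | a < f x} ≠ 0) :
    ∀ᵐ x ∂μ, ∃ᶠ N in atTop, birkhoffAvg T f (N + 1) x > d / (N : ℝ) + birkhoffAvg T f N x := by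
  obtain ⟨b, hb, hba⟩ := exists_between (lt_sub_iff_add_lt.2 had)
  have hint : ∫ x, (f x - b) ∂μ < 0 := by
    rw [integral_sub hf (integrable_const b)]
    simpa using hb
  have hbdd := hT.quasiMeasurePreserving.ae
    (ae_bddAbove_birkhoffSum hT (hf.sub (integrable_const b)) hint)
  have hvisit := hT.quasiMeasurePreserving.ae (hT.ae_frequently_iterate_mem
    (nullMeasurableSet_lt aemeasurable_const hf.aemeasurable) ha)
  filter_upwards [hbdd, hvisit] with x ⟨C, hC⟩ hx
  obtain ⟨K, hK⟩ := exists_nat_gt ((C + d) / (a - b - d))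
  refine (hx.and_eventually (eventually_ge_atTop (K + 1))).mono fun N ⟨hN, hNK⟩ => ?_
  have hN0 : (0 : ℝ) < N := by exact_mod_cast (Nat.succ_pos K).trans_le hNK
  have hKN : (K : ℝ) ≤ N := by exact_mod_cast (Nat.le_succ K).trans hNK
  have hlin : C + d < N * (a - b - d) :=
    (div_lt_iff₀ (by linarith)).1 (hK.trans_le hKN)
  have hS : birkhoffSum T f N (T x) ≤ C + N * b := by
    have h : birkhoffSum T (f - fun _ => b) N (T x) ≤ C := hC ⟨N, rfl⟩
    simp only [birkhoffSum, Pi.sub_apply, Finset.sum_sub_distrib, Finset.sum_const,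
      Finset.card_range, nsmul_eq_mul] at h ⊢
    linarith
  have hN' : a < f (T^[N] (T x)) := hN
  rw [birkhoffAvg_eq_birkhoffSum, birkhoffAvg_eq_birkhoffSum, birkhoffSum_succ, gt_iff_lt,
    ← sub_pos]
  set S := birkhoffSum T f N (T x)
  set y := f (T^[N] (T x))
  have key : ((N + 1 : ℕ) : ℝ)⁻¹ * (S + y) - (d / N + (N : ℝ)⁻¹ * S) =
      (N * y - S - d * (N + 1)) / (N * (N + 1)) := by
    push_cast
    field_simp
    ring
  rw [key]
  refine div_pos ?_ (by positivity)
  nlinarith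

/-- A non-constant integrable function exceeds its mean by some definite amount on a set of
positive measure. -/
lemma exists_pos_measure_integral_add_lt_ne_zero {X : Type*} [MeasurableSpace X] {μ : Measure X}
    [IsProbabilityMeasure μ] {f : X → ℝ} (hf : Integrable f μ)
    (hnc : ¬ ∃ c : ℝ, f =ᵐ[μ] fun _ => c) :
    ∃ d : ℝ, 0 < d ∧ μ {x | ∫ y, f y ∂μ + d < f x} ≠ 0 := by
  by_contra! H
  have hle : ∀ᵐ x ∂μ, f x ≤ ∫ y, f y ∂μ := by
    have h (n : ℕ) : ∀ᵐ x ∂μ, f x ≤ ∫ y, f y ∂μ + 1 / ((n : ℝ) + 1) := by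
      simpa [ae_iff] using H (1 / ((n : ℝ) + 1)) Nat.one_div_pos_of_nat
    filter_upwards [ae_all_iff.2 h] with x hx
    refine le_of_forall_pos_le_add fun ε hε => ?_
    obtain ⟨n, hn⟩ := exists_nat_one_div_lt hε
    linarith [hx n]
  refine hnc ⟨∫ y, f y ∂μ, ?_⟩
  have hzero : ∫ x, (∫ y, f y ∂μ - f x) ∂μ = 0 := by
    rw [integral_sub (integrable_const _) hf]
    simp
  rw [integral_eq_zero_iff_of_nonneg_ae (hle.mono fun x hx => sub_nonneg.2 hx)
    ((integrable_const _).sub hf)] at hzero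
  exact hzero.mono fun x hx => (sub_eq_zero.1 hx).symm

theorem stmt_1 {X : Type*} [MeasurableSpace X] (μ : Measure X) [IsProbabilityMeasure μ]
    (f : X → ℝ) (hf : Integrable f μ)
    (hnc : ¬ ∃ c : ℝ, f =ᵐ[μ] fun _ => c) :
    ∃ d : ℝ, 0 < d ∧ ∀ T : X → X, Ergodic T μ →
      ∀ᵐ x ∂μ,
        (∃ᶠ N in atTop, birkhoffAvg T f (N + 1) x > d / (N : ℝ) + birkhoffAvg T f N x) ∧
        (∃ᶠ N in atTop, birkhoffAvg T f (N + 1) x < -(d / (N : ℝ)) + birkhoffAvg T f N x) := by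
  have hnc' : ¬ ∃ c : ℝ, -f =ᵐ[μ] fun _ => c := fun ⟨c, hc⟩ =>
    hnc ⟨-c, hc.mono fun x hx => neg_eq_iff_eq_neg.1 hx⟩
  obtain ⟨d₁, hd₁, h₁⟩ := exists_pos_measure_integral_add_lt_ne_zero hf hnc
  obtain ⟨d₂, hd₂, h₂⟩ := exists_pos_measure_integral_add_lt_ne_zero hf.neg hnc'
  refine ⟨min d₁ d₂ / 2, by positivity, fun T hT => ?_⟩
  have hmin : 0 < min d₁ d₂ := lt_min hd₁ hd₂
  filter_upwards [
    ae_frequently_birkhoffAvg_succ_gt (d := min d₁ d₂ / 2) hT hf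
      (by linarith [min_le_left d₁ d₂]) h₁,
    ae_frequently_birkhoffAvg_succ_gt (d := min d₁ d₂ / 2) hT hf.neg
      (by linarith [min_le_right d₁ d₂]) h₂] with x hx₁ hx₂
  refine ⟨hx₁, hx₂.mono fun N hN => ?_⟩
  have hneg (n : ℕ) : birkhoffAvg T (-f) n x = -birkhoffAvg T f n x := by
    simp [birkhoffAvg]
  rw [hneg, hneg] at hN
  linarith
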